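/- For every ε > 0 one has G(ĉ + ε) < 0, and for every ε ∈ (0, ĉ) one has G(ĉ − ε) > 0. -/

import Mathlib

open MeasureTheory Filter Set Topology

open scoped Classical in
/-- Cumulant generating function valued in `EReal` (equal to `+∞` where the
moment generating function is infinite). -/
noncomputable def cgfE {Ω : Type*} [MeasurableSpace Ω] (μ : Measure Ω) (X : Ω → ℝ) (t : ℝ) :
    EReal :=
  if Integrable (fun ω => Real.exp (t * X ω)) μ then
    ((Real.log (∫ ω, Real.exp (t * X ω) ∂μ) : ℝ) : EReal)
  else ⊤

/-- Real-valued version of the cumulant generating function (meaningful where the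
moment generating function is finite). -/
noncomputable def cgfR {Ω : Type*} [MeasurableSpace Ω] (μ : Measure Ω) (X : Ω → ℝ) (t : ℝ) :
    ℝ :=
  Real.log (∫ ω, Real.exp (t * X ω) ∂μ)

/-- The Cramér (Legendre) rate function `I(x) = sup_t (t x - Λ(t))`, valued in `[0,∞]`. -/
noncomputable def rateI {Ω : Type*} [MeasurableSpace Ω] (μ : Measure Ω) (X : Ω → ℝ) (x : ℝ) :
    EReal :=
  ⨆ t : ℝ, (((t * x : ℝ) : EReal) - cgfE μ X t)

/-- `λ* = sup {λ ≥ 0 : E[exp(λ X)] < ∞}`, valued in `EReal`. -/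
noncomputable def lamStar {Ω : Type*} [MeasurableSpace Ω] (μ : Measure Ω) (X : Ω → ℝ) :
    EReal :=
  sSup {l : EReal | ∃ lr : ℝ, l = (lr : EReal) ∧ 0 ≤ lr ∧
    Integrable (fun ω => Real.exp (lr * X ω)) μ}

/-- `x* = sup {x ≥ 0 : I(x) ≤ log m}`. -/
noncomputable def xStar {Ω : Type*} [MeasurableSpace Ω] (μ : Measure Ω) (X : Ω → ℝ)
    (m : ℝ) : ℝ :=
  sSup {x : ℝ | 0 ≤ x ∧ rateI μ X x ≤ ((Real.log m : ℝ) : EReal)}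

/-- `G(c) = log m − I(θx* + c) − a`, valued in `[-∞, ∞)`. -/
noncomputable def gBig {Ω : Type*} [MeasurableSpace Ω] (μ : Measure Ω) (X : Ω → ℝ)
    (m θ a c : ℝ) : EReal :=
  ((Real.log m : ℝ) : EReal) - rateI μ X (θ * xStar μ X m + c) - ((a : ℝ) : EReal)

/-- `ĉ = inf {c ≥ 0 : G(c) < 0}`. -/
noncomputable def cHat {Ω : Type*} [MeasurableSpace Ω] (μ : Measure Ω) (X : Ω → ℝ)
    (m θ a : ℝ) : ℝ :=
  sInf {c : ℝ | 0 ≤ c ∧ gBig μ X m θ a c < 0}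

/-- A real number bounds the rate function at `x` iff it bounds all `t * x - Λ(t)` with
`Λ(t)` finite. -/
lemma rateI_le_coe_iff {Ω : Type*} [MeasurableSpace Ω] (μ : Measure Ω) (X : Ω → ℝ) (x p : ℝ) :
    rateI μ X x ≤ (p : EReal) ↔
      ∀ t : ℝ, Integrable (fun ω => Real.exp (t * X ω)) μ → t * x - cgfR μ X t ≤ p := by
  unfold rateI
  rw [iSup_le_iff]
  refine forall_congr' fun t => ?_
  by_cases h : Integrable (fun ω => Real.exp (t * X ω)) μ
  · simp only [cgfE, cgfR, h, if_true, forall_const]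
    rw [← EReal.coe_sub, EReal.coe_le_coe_iff]
  · simp [cgfE, h]

/-- Convexity of the rate function, in terms of real upper bounds. -/
lemma rateI_convex_le {Ω : Type*} [MeasurableSpace Ω] (μ : Measure Ω) (X : Ω → ℝ)
    {x y p q s u : ℝ} (hx : rateI μ X x ≤ (p : EReal)) (hy : rateI μ X y ≤ (q : EReal))
    (hs : 0 ≤ s) (hu : 0 ≤ u) (hsu : s + u = 1) :
    rateI μ X (s * x + u * y) ≤ ((s * p + u * q : ℝ) : EReal) := by
  rw [rateI_le_coe_iff] at *
  intro t ht
  calc t * (s * x + u * y) - cgfR μ X t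
      = s * (t * x - cgfR μ X t) + u * (t * y - cgfR μ X t) := by
        linear_combination -(cgfR μ X t) * (-hsu)
    _ ≤ s * p + u * q :=
        add_le_add (mul_le_mul_of_nonneg_left (hx t ht) hs)
          (mul_le_mul_of_nonneg_left (hy t ht) hu)

/-- If the rate function is below the level `q` at `x` and at most `q` at `x + d`, then it is
below `q` at all points `x + c` with `0 ≤ c < d`. -/
lemma exists_lt_rateI_le {Ω : Type*} [MeasurableSpace Ω] (μ : Measure Ω) (X : Ω → ℝ)
    {x p q c d : ℝ} (hx : rateI μ X x ≤ (p : EReal)) (hpq : p < q)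
    (hd : rateI μ X (x + d) ≤ (q : EReal)) (hc : 0 ≤ c) (hcd : c < d) :
    ∃ r : ℝ, r < q ∧ rateI μ X (x + c) ≤ (r : EReal) := by
  have hd0 : 0 < d := hc.trans_lt hcd
  have hs : 0 < 1 - c / d := sub_pos.2 ((div_lt_one hd0).2 hcd)
  refine ⟨(1 - c / d) * p + c / d * q, by nlinarith, ?_⟩
  have h := rateI_convex_le μ X hx hd hs.le (by positivity : 0 ≤ c / d) (by ring)
  have e : (1 - c / d) * x + c / d * (x + d) = x + c := by
    field_simp
    ring
  rwa [e] at h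

lemma gBig_neg_iff {Ω : Type*} [MeasurableSpace Ω] (μ : Measure Ω) (X : Ω → ℝ)
    (m θ a c : ℝ) :
    gBig μ X m θ a c < 0 ↔
      ¬ rateI μ X (θ * xStar μ X m + c) ≤ ((Real.log m - a : ℝ) : EReal) := by
  unfold gBig
  generalize rateI μ X (θ * xStar μ X m + c) = r
  induction r using EReal.rec with
  | bot => simp
  | top => simp [-EReal.coe_sub]
  | coe r =>
    rw [← EReal.coe_sub, ← EReal.coe_sub, EReal.coe_le_coe_iff, ← EReal.coe_zero,
      EReal.coe_lt_coe_iff, not_le]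
    constructor <;> intro h <;> linarith

lemma gBig_pos {Ω : Type*} [MeasurableSpace Ω] (μ : Measure Ω) (X : Ω → ℝ)
    {m θ a c p : ℝ} (hp : p < Real.log m - a)
    (h : rateI μ X (θ * xStar μ X m + c) ≤ (p : EReal)) : 0 < gBig μ X m θ a c := by
  unfold gBig
  generalize rateI μ X (θ * xStar μ X m + c) = r at h
  induction r using EReal.rec with
  | bot => simp
  | top => simp at h
  | coe r =>
    rw [EReal.coe_le_coe_iff] at h
    rw [← EReal.coe_sub, ← EReal.coe_sub, ← EReal.coe_zero, EReal.coe_lt_coe_iff]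
    linarith

/-- A strict bound `a < b - r` in `EReal` provides a real upper bound of `r` below `b - a`. -/
lemma exists_real_bound_of_lt_sub {a b : ℝ} {r : EReal} (h : (a : EReal) < (b : EReal) - r) :
    ∃ p : ℝ, p < b - a ∧ r ≤ (p : EReal) := by
  induction r using EReal.rec with
  | bot => exact ⟨b - a - 1, by linarith, bot_le⟩
  | top => simp at h
  | coe r =>
    rw [← EReal.coe_sub, EReal.coe_lt_coe_iff] at h
    exact ⟨r, by linarith, le_rfl⟩

theorem stmt15 {Ω : Type*} [MeasurableSpace Ω] (μ : Measure Ω) [IsProbabilityMeasure μ]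
    (X : Ω → ℝ) (hmeas : Measurable X) (hint : Integrable X μ)
    (hmean : ∫ ω, X ω ∂μ = 0) (hX0 : μ {ω | X ω = 0} < 1)
    (hmom : ∃ κ : ℝ, 0 < κ ∧ Integrable (fun ω => Real.exp (κ * X ω)) μ)
    (m θ a : ℝ) (hm : 1 < m) (hθ0 : 0 ≤ θ) (hθ1 : θ < 1)
    (ha0 : 0 ≤ a) (ha : (a : EReal) < ((Real.log m : ℝ) : EReal) - rateI μ X (θ * xStar μ X m))
    (hxB : BddAbove {x : ℝ | 0 ≤ x ∧ rateI μ X x ≤ ((Real.log m : ℝ) : EReal)})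
    (hxpos : 0 < xStar μ X m) :
    (∀ ε : ℝ, 0 < ε → gBig μ X m θ a (cHat μ X m θ a + ε) < 0) ∧
    (∀ ε : ℝ, 0 < ε → ε < cHat μ X m θ a → 0 < gBig μ X m θ a (cHat μ X m θ a - ε)) := by
  obtain ⟨p, hp, hIp⟩ := exists_real_bound_of_lt_sub ha
  have hbdd : BddBelow {c : ℝ | 0 ≤ c ∧ gBig μ X m θ a c < 0} := ⟨0, fun c hc => hc.1⟩
  have hne : {c : ℝ | 0 ≤ c ∧ gBig μ X m θ a c < 0}.Nonempty := by
    have hθx : 0 ≤ θ * xStar μ X m := mul_nonneg hθ0 hxpos.le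
    refine ⟨xStar μ X m + 1, by linarith, (gBig_neg_iff ..).2 fun h => ?_⟩
    have hle : θ * xStar μ X m + (xStar μ X m + 1) ≤ xStar μ X m :=
      le_csSup hxB ⟨by linarith, h.trans (EReal.coe_le_coe_iff.2 (by linarith))⟩
    linarith
  refine ⟨fun ε hε => ?_, fun ε hε hlt => ?_⟩
  · obtain ⟨c, ⟨hc0, hc⟩, hclt⟩ := exists_lt_of_csInf_lt hne (lt_add_of_pos_right _ hε)
    rw [gBig_neg_iff] at hc ⊢
    intro h
    obtain ⟨r, hr, hIr⟩ := exists_lt_rateI_le μ X hIp hp h hc0 hclt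
    exact hc (hIr.trans (EReal.coe_le_coe_iff.2 hr.le))
  · have hmid : rateI μ X (θ * xStar μ X m + (cHat μ X m θ a - ε / 2)) ≤
        ((Real.log m - a : ℝ) : EReal) := by
      by_contra h
      have hle : cHat μ X m θ a ≤ cHat μ X m θ a - ε / 2 :=
        csInf_le hbdd ⟨by linarith, (gBig_neg_iff ..).2 h⟩
      linarith
    obtain ⟨r, hr, hIr⟩ := exists_lt_rateI_le μ X (c := cHat μ X m θ a - ε) hIp hp hmid
      (by linarith) (by linarith)
    exact gBig_pos μ X hr hIr
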